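/- arXiv:2107.01876 — 2 statements merged into one kernel-verified Lean document; each statement's English description precedes it below -/
import Mathlib

section
/- Let (G_n) be a sequence of connected DAGs, where G_n is over a target Y and d_n covariates with d_n → ∞, and let d_{>2}(G_n) denote the number of vertices of G_n whose degree in the skeleton is at least 3. If d_{>2}(G_n)/log(d_n) → ∞, then N_{G_n} grows superpolynomially in d_n: for every natural number m, N_{G_n}/d_n^m → ∞. -/
/-- A finite directed acyclic graph on a vertex type `V`: an edge relation with no
directed cycles. -/
structure DAG (V : Type*) where
  edge : V → V → Prop
  acyclic : ∀ v, ¬ Relation.TransGen edge v v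

/-- A path: a sequence of at least two distinct vertices in which consecutive vertices
are joined by an edge (in either direction). -/
def IsPath {V : Type*} (E : V → V → Prop) (p : List V) : Prop :=
  2 ≤ p.length ∧ p.Nodup ∧
    ∀ i, ∀ h : i + 1 < p.length,
      E (p.get ⟨i, Nat.lt_of_succ_lt h⟩) (p.get ⟨i + 1, h⟩) ∨
      E (p.get ⟨i + 1, h⟩) (p.get ⟨i, Nat.lt_of_succ_lt h⟩)

/-- The vertex at position `i` of the path `p` is a collider on `p`: it is an interior
vertex and both adjacent edges of the path point into it. -/
def IsColliderAt {V : Type*} (E : V → V → Prop) (p : List V) (i : ℕ) : Prop :=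
  ∃ (h1 : 1 ≤ i) (h2 : i + 1 < p.length),
    E (p.get ⟨i - 1, by omega⟩) (p.get ⟨i, by omega⟩) ∧
    E (p.get ⟨i + 1, h2⟩) (p.get ⟨i, by omega⟩)

/-- A path is blocked by a vertex set `Z` if it contains a non-collider belonging to
`Z`, or a collider such that neither the collider itself nor any of its descendants
belongs to `Z`. -/
def Blocked {V : Type*} (E : V → V → Prop) (Z : Set V) (p : List V) : Prop :=
  (∃ i, ∃ h : i < p.length, ¬ IsColliderAt E p i ∧ p.get ⟨i, h⟩ ∈ Z) ∨
  (∃ i, ∃ h : i < p.length, IsColliderAt E p i ∧ p.get ⟨i, h⟩ ∉ Z ∧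
    ∀ w, Relation.TransGen E (p.get ⟨i, h⟩) w → w ∉ Z)

/-- `p` is a path between the vertices `u` and `v`. -/
def PathBetween {V : Type*} (E : V → V → Prop) (p : List V) (u v : V) : Prop :=
  IsPath E p ∧ p.head? = some u ∧ p.getLast? = some v

/-- `A` is d-separated from `B` given `Z`: every path between a vertex of `A` and a
vertex of `B` is blocked by `Z`. -/
def DSep {V : Type*} (E : V → V → Prop) (A B Z : Set V) : Prop :=
  ∀ (p : List V) (u v : V), PathBetween E p u v → u ∈ A → v ∈ B → Blocked E Z p

/-- The set of covariate vertices (in `Option ι`, the target is `none` and the covariate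
with index `i` is `some i`) indexed by a finite index set `S`. -/
def XSet {ι : Type*} (S : Finset ι) : Set (Option ι) := {v | ∃ i ∈ S, v = some i}

/-- The equivalence relation `∼_G` on subsets of the covariate index set: `S' ∼_G S''`
iff there is `S_∩ ⊆ S' ∩ S''` such that the target `Y` (= `none`) is d-separated from
`X_{(S' ∪ S'') ∖ S_∩}` given `X_{S_∩}` in `G`. -/
def SimG {ι : Type*} [DecidableEq ι] (G : DAG (Option ι)) (S' S'' : Finset ι) : Prop :=
  ∃ Scap : Finset ι, Scap ⊆ S' ∩ S'' ∧
    DSep G.edge {none} (XSet ((S' ∪ S'') \ Scap)) (XSet Scap)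

/-- `N_G`: the number of equivalence classes of `∼_G`. -/
noncomputable def NG {ι : Type*} [DecidableEq ι] (G : DAG (Option ι)) : ℕ :=
  Nat.card (Quot (SimG G))

/-- Adjacency in the skeleton of a DAG. -/
def SkelAdj {V : Type*} (G : DAG V) (a b : V) : Prop := G.edge a b ∨ G.edge b a

/-- The degree of a vertex in the skeleton of a DAG: its number of neighbours. -/
noncomputable def skelDeg {V : Type*} (G : DAG V) (v : V) : ℕ :=
  Nat.card {w | SkelAdj G v w}

/-- `d_{>2}(G)`: the number of vertices whose degree in the skeleton is at least 3. -/
noncomputable def numHighDeg {V : Type*} (G : DAG V) : ℕ :=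
  Nat.card {v | 3 ≤ skelDeg G v}


namespace NGaux

/-- Walk reachability: `Act E Z y v b` holds when there is an active walk from `y` to `v` (colliders in `Z`,
non-colliders outside `Z`); `b` tells whether the last edge points into `v`. -/
inductive Act {V : Type*} (E : V → V → Prop) (Z : Set V) (y : V) : V → Bool → Prop
  | start : Act E Z y y false
  | fwd {u w : V} {b : Bool} : Act E Z y u b → u ∉ Z → E u w → Act E Z y w true
  | bwdN {u w : V} : Act E Z y u false → u ∉ Z → E w u → Act E Z y w false
  | bwdC {u w : V} : Act E Z y u true → u ∈ Z → E w u → Act E Z y w false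

theorem act_mono {V : Type*} {E : V → V → Prop} {C D : Set V} {y : V}
    (h : ∀ v b, Act E C y v b → v ∉ D) {v : V} {b : Bool} (hv : Act E C y v b) :
    Act E (C ∪ D) y v b := by
  induction hv with
  | start => exact Act.start
  | fwd h1 h2 h3 ih => exact Act.fwd ih (by simp [h2, h _ _ h1]) h3
  | bwdN h1 h2 h3 ih => exact Act.bwdN ih (by simp [h2, h _ _ h1]) h3
  | bwdC h1 h2 h3 ih => exact Act.bwdC ih (by simp [h2]) h3

theorem act_anti {V : Type*} {E : V → V → Prop} {C D : Set V} {y : V}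
    (h : ∀ v b, Act E C y v b → v ∉ D) {v : V} {b : Bool} (hv : Act E (C ∪ D) y v b) :
    Act E C y v b := by
  induction hv with
  | start => exact Act.start
  | fwd h1 h2 h3 ih => exact Act.fwd ih (fun hc => h2 (Or.inl hc)) h3
  | bwdN h1 h2 h3 ih => exact Act.bwdN ih (fun hc => h2 (Or.inl hc)) h3
  | bwdC h1 h2 h3 ih =>
    refine Act.bwdC ih ?_ h3
    rcases h2 with h2 | h2
    · exact h2
    · exact absurd h2 (h _ _ ih)

/-- `v` or a descendant of `v` belongs to `Z`. -/
def AnZ {V : Type*} (E : V → V → Prop) (Z : Set V) (v : V) : Prop :=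
  ∃ w, Relation.ReflTransGen E v w ∧ w ∈ Z

/-- An open path of length `n`, given as a function. -/
structure OpenP {V : Type*} (E : V → V → Prop) (Z : Set V) (y : V) (p : ℕ → V) (n : ℕ) : Prop where
  zero : p 0 = y
  inj : ∀ i j, i ≤ n → j ≤ n → p i = p j → i = j
  adj : ∀ i, i < n → E (p i) (p (i+1)) ∨ E (p (i+1)) (p i)
  col : ∀ i, i + 1 < n → E (p i) (p (i+1)) → E (p (i+2)) (p (i+1)) → AnZ E Z (p (i+1))
  ncol : ∀ i, i + 1 < n → ¬ (E (p i) (p (i+1)) ∧ E (p (i+2)) (p (i+1))) → p (i+1) ∉ Z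

theorem OpenP.trunc {V : Type*} {E : V → V → Prop} {Z : Set V} {y : V} {p : ℕ → V} {n m : ℕ}
    (h : OpenP E Z y p n) (hm : m ≤ n) : OpenP E Z y p m :=
  ⟨h.zero, fun i j hi hj => h.inj i j (hi.trans hm) (hj.trans hm),
   fun i hi => h.adj i (hi.trans_le hm), fun i hi => h.col i (hi.trans_le hm),
   fun i hi => h.ncol i (hi.trans_le hm)⟩

theorem OpenP.extend {V : Type*} {E : V → V → Prop} {Z : Set V} {y : V} {p : ℕ → V} {n : ℕ} {w : V}
    (h : OpenP E Z y p n) (hw : ∀ i ≤ n, p i ≠ w) (ha : E (p n) w ∨ E w (p n))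
    (hc : ∀ i, i + 1 = n → E (p i) (p (i+1)) → E w (p n) → AnZ E Z (p n))
    (hnc : ∀ i, i + 1 = n → ¬ (E (p i) (p (i+1)) ∧ E w (p n)) → p n ∉ Z) :
    OpenP E Z y (fun i => if i ≤ n then p i else w) (n+1) := by
  refine ⟨by simp [h.zero], ?_, ?_, ?_, ?_⟩
  · intro i j hi hj he
    split_ifs at he with h1 h2 h2
    · exact h.inj i j h1 h2 he
    · exact absurd he (hw i h1)
    · exact absurd he.symm (hw j h2)
    · omega
  · intro i hi
    by_cases h1 : i + 1 ≤ n
    · simp only [h1, (by omega : i ≤ n), if_true]; exact h.adj i (by omega)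
    · obtain rfl : i = n := by omega
      simpa using ha
  · intro i hi
    by_cases h1 : i + 2 ≤ n
    · simp only [h1, (by omega : i ≤ n), (by omega : i + 1 ≤ n), if_true]; exact h.col i (by omega)
    · obtain rfl : n = i + 1 := by omega
      simpa using hc i rfl
  · intro i hi
    by_cases h1 : i + 2 ≤ n
    · simp only [h1, (by omega : i ≤ n), (by omega : i + 1 ≤ n), if_true]; exact h.ncol i (by omega)
    · obtain rfl : n = i + 1 := by omega
      simpa using hnc i rfl

/-- If an open path leaves position `i` forward, but arrives at the end backward, there is a collider below. -/
theorem OpenP.follow {V : Type*} {E : V → V → Prop} {Z : Set V} {y : V} {p : ℕ → V} {n : ℕ}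
    (h : OpenP E Z y p n) (k : ℕ) : ∀ i, i + 1 + k = n → E (p i) (p (i+1)) →
      AnZ E Z (p i) ∨ (E (p (n-1)) (p n) ∧ Relation.ReflTransGen E (p i) (p n)) := by
  induction k with
  | zero =>
    intro i hi he
    obtain rfl : n = i + 1 := by omega
    exact Or.inr ⟨by simpa using he, Relation.ReflTransGen.single he⟩
  | succ k ih =>
    intro i hi he
    rcases h.adj (i+1) (by omega) with h1 | h1
    · rcases ih (i+1) (by omega) h1 with ⟨w, hw, hz⟩ | ⟨ha, hb⟩
      · exact Or.inl ⟨w, Relation.ReflTransGen.head he hw, hz⟩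
      · exact Or.inr ⟨ha, Relation.ReflTransGen.head he hb⟩
    · obtain ⟨w, hw, hz⟩ := h.col i (by omega) he h1
      exact Or.inl ⟨w, Relation.ReflTransGen.head he hw, hz⟩

theorem act_path {V : Type*} {E : V → V → Prop} (hacyc : ∀ v, ¬ Relation.TransGen E v v)
    {Z : Set V} {y : V} (hy : y ∉ Z) {v : V} {b : Bool} (hv : Act E Z y v b) :
    ∃ p n, OpenP E Z y p n ∧ p n = v ∧
      (b = true → v ∉ Z ∨ ∃ i, i + 1 = n ∧ E (p i) (p (i+1))) ∧
      (b = false → AnZ E Z v ∨ ∀ i, i + 1 = n → ¬ E (p i) (p (i+1))) := by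
  have asym : ∀ a b, E a b → ¬ E b a := fun a b h1 h2 =>
    hacyc a (Relation.TransGen.tail (Relation.TransGen.single h1) h2)
  have irr : ∀ a, ¬ E a a := fun a h => hacyc a (Relation.TransGen.single h)
  induction hv with
  | start =>
    exact ⟨fun _ => y, 0, ⟨rfl, by intros; omega, by intros; omega, by intros; omega,
      by intros; omega⟩, rfl, by simp, fun _ => Or.inr (by intros; omega)⟩
  | @fwd u w b h1 h2 h3 ih =>
    obtain ⟨p, n, hp, rfl, -, -⟩ := ih
    by_cases hw : ∀ i ≤ n, p i ≠ w
    · refine ⟨_, n+1, hp.extend hw (Or.inl h3) (fun i _ _ h => absurd h (asym _ _ h3))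
        (fun i _ _ => h2), by simp, fun _ => Or.inr ⟨n, rfl, by simpa using h3⟩, by simp⟩
    · push Not at hw
      obtain ⟨i, hi, rfl⟩ := hw
      refine ⟨p, i, hp.trunc hi, rfl, fun _ => ?_, by simp⟩
      have hin : i ≠ n := by rintro rfl; exact irr _ h3
      cases i with
      | zero => left; rw [hp.zero]; exact hy
      | succ i =>
        by_cases hE : E (p i) (p (i+1))
        · exact Or.inr ⟨i, rfl, hE⟩
        · exact Or.inl (hp.ncol i (by omega) (fun h => hE h.1))
  | @bwdN u w h1 h2 h3 ih =>
    obtain ⟨p, n, hp, rfl, -, hf⟩ := ih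
    have hf := hf rfl
    by_cases hw : ∀ i ≤ n, p i ≠ w
    · refine ⟨_, n+1, hp.extend hw (Or.inr h3) (fun i hi h _ => ?_)
        (fun i _ _ => h2), by simp, by simp, fun _ => Or.inr ?_⟩
      · rcases hf with hf | hf
        · exact hf
        · exact absurd h (hf i hi)
      · intro i hi
        obtain rfl : i = n := by omega
        simpa using asym _ _ h3
    · push Not at hw
      obtain ⟨i, hi, rfl⟩ := hw
      refine ⟨p, i, hp.trunc hi, rfl, by simp, fun _ => ?_⟩
      have hin : i ≠ n := by rintro rfl; exact irr _ h3
      rcases hf with ⟨x, hx, hz⟩ | hf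
      · exact Or.inl ⟨x, Relation.ReflTransGen.head h3 hx, hz⟩
      · by_cases hE : E (p i) (p (i+1))
        · rcases hp.follow (n - (i+1)) i (by omega) hE with h | h
          · exact Or.inl h
          · exact absurd (by rw [Nat.sub_add_cancel (by omega)]; exact h.1) (hf (n-1) (by omega))
        · have hE' := (hp.adj i (by omega)).resolve_left hE
          cases i with
          | zero => right; intros; omega
          | succ i =>
            by_cases hE2 : E (p i) (p (i+1))
            · exact Or.inl (hp.col i (by omega) hE2 hE')
            · right; intro j hj; obtain rfl : j = i := by omega
              exact hE2
  | @bwdC u w h1 h2 h3 ih =>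
    obtain ⟨p, n, hp, rfl, ht, -⟩ := ih
    obtain ⟨i, hi, hE⟩ := (ht rfl).resolve_left (fun h => h h2)
    have hAn : AnZ E Z w := ⟨_, Relation.ReflTransGen.single h3, h2⟩
    by_cases hw : ∀ i ≤ n, p i ≠ w
    · refine ⟨_, n+1, hp.extend hw (Or.inr h3) (fun i hi h _ => ⟨_, .refl, h2⟩)
        (fun j hj h => ?_), by simp, by simp, fun _ => Or.inl hAn⟩
      obtain rfl : j = i := by omega
      exact absurd ⟨hE, h3⟩ h
    · push Not at hw
      obtain ⟨i, hi, rfl⟩ := hw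
      exact ⟨p, i, hp.trunc hi, rfl, by simp, fun _ => Or.inl hAn⟩

theorem OpenP.not_blocked {V : Type*} {E : V → V → Prop} {Z : Set V} {y : V} {p : ℕ → V} {n : ℕ}
    (h : OpenP E Z y p n) (hn : 0 < n) (hy : y ∉ Z) (hz : p n ∉ Z) :
    PathBetween E (List.ofFn (fun i : Fin (n+1) => p i)) y (p n) ∧
    ¬ Blocked E Z (List.ofFn (fun i : Fin (n+1) => p i)) := by
  refine ⟨⟨⟨by simp; omega, ?_, ?_⟩, ?_, ?_⟩, ?_⟩
  · rw [List.nodup_ofFn]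
    intro i j hij
    exact Fin.ext (h.inj i j (by omega) (by omega) hij)
  · intro i hi
    simp only [List.length_ofFn] at hi
    simpa only [List.get_eq_getElem, List.getElem_ofFn] using h.adj i (by omega)
  · simp [h.zero]
  · simp [List.getLast?_eq_getElem?, -List.ofFn_succ]
  · rintro (⟨i, hi, hc, hZ⟩ | ⟨i, hi, ⟨h1, h2, hc1, hc2⟩, hZ, hd⟩)
    · simp only [List.length_ofFn] at hi
      simp only [List.get_eq_getElem, List.getElem_ofFn] at hZ
      rcases i with _ | i
      · rw [h.zero] at hZ; exact hy hZ
      · rcases Nat.lt_or_ge (i+1) n with hlt | hge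
        · refine h.ncol i hlt (fun hcc => hc ⟨by omega, by simp; omega, ?_⟩) hZ
          simpa only [List.get_eq_getElem, List.getElem_ofFn, Nat.add_sub_cancel] using hcc
        · obtain rfl : n = i + 1 := by omega
          exact hz hZ
    · simp only [List.length_ofFn] at hi h2
      simp only [List.get_eq_getElem, List.getElem_ofFn] at hc1 hc2 hZ hd
      obtain ⟨i, rfl⟩ : ∃ j, i = j + 1 := ⟨i-1, by omega⟩
      obtain ⟨w, hw, hwZ⟩ := h.col i (by omega) (by simpa using hc1) hc2
      rcases Relation.reflTransGen_iff_eq_or_transGen.1 hw with rfl | ht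
      · exact hZ hwZ
      · exact hd w ht hwZ

theorem act_of_dsep {V : Type*} (G : DAG V) {D Z : Set V} {y : V} (hy : y ∉ Z) (hyD : y ∉ D)
    (hDZ : ∀ v ∈ D, v ∉ Z) (h : DSep G.edge {y} D Z) (v : V) (b : Bool)
    (hv : Act G.edge Z y v b) : v ∉ D := by
  intro hD
  obtain ⟨p, n, hp, rfl, -, -⟩ := act_path G.acyclic hy hv
  have hn : 0 < n := by
    rcases Nat.eq_zero_or_pos n with rfl | h0
    · rw [hp.zero] at hD; exact absurd hD hyD
    · exact h0
  obtain ⟨h1, h2⟩ := hp.not_blocked hn hy (hDZ _ hD)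
  exact h2 (h _ _ _ h1 rfl hD)

open Classical in
/-- The invariant of the equivalence class: reachable elements of `S`. -/
noncomputable def inv {ι : Type*} (G : DAG (Option ι)) (S : Finset ι) : Finset ι :=
  S.filter (fun i => ∃ b, Act G.edge (XSet S) none (some i) b)

theorem mem_XSet {ι : Type*} (S : Finset ι) (i : ι) : some i ∈ XSet S ↔ i ∈ S := by
  simp [XSet]

theorem none_XSet {ι : Type*} (S : Finset ι) : none ∉ XSet S := by
  simp [XSet]

theorem inv_aux {ι : Type*} [DecidableEq ι] (G : DAG (Option ι)) (C S T : Finset ι) (hCS : C ⊆ S)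
    (hST : S ⊆ T) (h : DSep G.edge {none} (XSet (T \ C)) (XSet C)) : inv G S = inv G C := by
  have key : ∀ v b, Act G.edge (XSet C) none v b → v ∉ XSet (S \ C) := by
    intro v b hv hvS
    refine act_of_dsep G (none_XSet _) (none_XSet _) ?_ h v b hv ?_
    · rintro w ⟨i, hi, rfl⟩
      rw [mem_XSet]
      exact (Finset.mem_sdiff.1 hi).2
    · obtain ⟨i, hi, rfl⟩ := hvS
      rw [mem_XSet]
      exact Finset.sdiff_subset_sdiff hST le_rfl hi
  have hU : XSet S = XSet C ∪ XSet (S \ C) := by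
    ext v
    cases v with
    | none => simp [none_XSet]
    | some i =>
      simp only [Set.mem_union, mem_XSet, Finset.mem_sdiff]
      have := @hCS i
      tauto
  ext i
  simp only [inv, Finset.mem_filter]
  constructor
  · rintro ⟨hi, b, hb⟩
    rw [hU] at hb
    have hb' := act_anti key hb
    refine ⟨?_, b, hb'⟩
    by_contra hc
    exact key _ _ hb' ((mem_XSet _ _).2 (Finset.mem_sdiff.2 ⟨hi, hc⟩))
  · rintro ⟨hi, b, hb⟩
    exact ⟨hCS hi, b, by rw [hU]; exact act_mono key hb⟩

theorem inv_eq {ι : Type*} [DecidableEq ι] (G : DAG (Option ι)) (S T : Finset ι) (h : SimG G S T) :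
    inv G S = inv G T := by
  obtain ⟨C, hC, h⟩ := h
  rw [inv_aux G C S (S ∪ T) (hC.trans Finset.inter_subset_left) Finset.subset_union_left h,
    inv_aux G C T (S ∪ T) (hC.trans Finset.inter_subset_right) Finset.subset_union_right h]

/-- Reachability from `y` by skeleton walks whose interior avoids `A`. -/
inductive TR {V : Type*} (R : V → V → Prop) (A : Set V) (y : V) : V → Prop
  | start : TR R A y y
  | step {u w : V} : TR R A y u → u ∉ A → R u w → TR R A y w

theorem desc {V : Type*} [Finite V] (G : DAG V) {S H : Set V} {y : V}
    (hS : ∀ v ∈ H, v ∉ S → v = y ∨ ∃ c ∈ H, G.edge v c) (u : V) (hu : u ∈ H)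
    (ha : Act G.edge S y u true) : u ∈ S ∨ Act G.edge S y u false := by
  have hwf : WellFounded (fun a b => Relation.TransGen G.edge b a) := by
    have : IsTrans V (fun a b => Relation.TransGen G.edge b a) :=
      ⟨fun a b c h1 h2 => Relation.TransGen.trans h2 h1⟩
    have : Std.Irrefl (fun a b => Relation.TransGen G.edge b a) := ⟨fun a => G.acyclic a⟩
    exact Finite.wellFounded_of_trans_of_irrefl _
  induction u using hwf.induction with
  | _ u ih =>
    by_cases huS : u ∈ S
    · exact Or.inl huS
    · right
      rcases hS u hu huS with rfl | ⟨c, hc, he⟩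
      · exact Act.start
      · have hc' : Act G.edge S y c true := Act.fwd ha huS he
        by_cases hcS : c ∈ S
        · exact Act.bwdC hc' hcS he
        · exact Act.bwdN ((ih c (Relation.TransGen.single he) hc hc').resolve_left hcS) hcS he

theorem reach {V : Type*} [Finite V] (G : DAG V) {S H A : Set V} {y : V}
    (hS : ∀ v ∈ H, v ∉ S → v = y ∨ ∃ c ∈ H, G.edge v c)
    (hy : y ∉ S) (hAH : ∀ v, v ∉ A → v ∈ H)
    (hS2 : ∀ v ∈ S, v ∉ A → ∀ c ∈ H, ¬ G.edge v c) (v : V) (hv : v ∈ H)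
    (hT : TR (SkelAdj G) A y v) :
    Act G.edge S y v true ∨ (Act G.edge S y v false ∧ (v ∉ S ∨ v ∈ A)) := by
  induction hT with
  | start => exact Or.inr ⟨Act.start, Or.inl hy⟩
  | @step u w h1 h2 h3 ih =>
    have huH := hAH u h2
    have ih := ih huH
    rcases h3 with h3 | h3
    · have huS : u ∉ S := fun hc => hS2 u hc h2 w hv h3
      rcases ih with ih | ih
      · exact Or.inl (Act.fwd ih huS h3)
      · exact Or.inl (Act.fwd ih.1 huS h3)
    · right
      refine ⟨?_, ?_⟩
      · by_cases huS : u ∈ S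
        · rcases ih with ih | ih
          · exact Act.bwdC ih huS h3
          · rcases ih.2 with h | h <;> contradiction
        · have : Act G.edge S y u false := by
            rcases ih with ih | ih
            · exact (desc G hS u huH ih).resolve_left huS
            · exact ih.1
          exact Act.bwdN this huS h3
      · by_contra hcon
        push Not at hcon
        exact hS2 w hcon.1 hcon.2 u huH h3

open Classical in
theorem two_pow_le {ι : Type*} [Fintype ι] [DecidableEq ι] (G : DAG (Option ι)) (A : Finset (Option ι))
    (hyA : none ∉ A) (hT : ∀ v, TR (SkelAdj G) (A : Set (Option ι)) none v) :
    2 ^ A.card ≤ NG G := by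
  let Hs : Finset (Option ι) → Set (Option ι) := fun B => {v | v ∈ A → v ∈ B}
  let SB : Finset (Option ι) → Finset ι := fun B =>
    Finset.univ.filter (fun i => some i ∈ Hs B ∧ (some i ∈ B ∨ ∀ c ∈ Hs B, ¬ G.edge (some i) c))
  have hmem : ∀ B i, i ∈ SB B ↔ some i ∈ Hs B ∧ (some i ∈ B ∨ ∀ c ∈ Hs B, ¬ G.edge (some i) c) := by
    intro B i; simp [SB]
  have hinv : ∀ B ⊆ A, inv G (SB B) = SB B := by
    intro B hB
    apply Finset.filter_true_of_mem
    intro i hi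
    have hi' := (hmem B i).1 hi
    have := reach G (S := XSet (SB B)) (H := Hs B) (A := A) (y := none) ?_ (none_XSet _) ?_ ?_
      (some i) hi'.1 (hT _)
    · rcases this with h | h
      · exact ⟨_, h⟩
      · exact ⟨_, h.1⟩
    · intro v hv hvS
      cases v with
      | none => exact Or.inl rfl
      | some j =>
        right
        rw [mem_XSet, hmem] at hvS
        by_contra hcon
        push Not at hcon
        exact hvS ⟨hv, Or.inr hcon⟩
    · intro v hv hvA
      exact absurd hvA hv
    · rintro v ⟨j, hj, rfl⟩ hvA
      rcases ((hmem B j).1 hj).2 with h | h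
      · exact absurd (hB h) hvA
      · exact h
  let f : Quot (SimG G) → Finset ι := Quot.lift (inv G) (inv_eq G)
  let g : {B // B ∈ A.powerset} → Quot (SimG G) := fun B => Quot.mk _ (SB B.1)
  have hg : Function.Injective g := by
    rintro ⟨B, hB⟩ ⟨B', hB'⟩ h
    have h2 : f (g ⟨B, hB⟩) = f (g ⟨B', hB'⟩) := by rw [h]
    rw [Finset.mem_powerset] at hB hB'
    change inv G (SB B) = inv G (SB B') at h2
    rw [hinv B hB, hinv B' hB'] at h2
    have hback : ∀ C ⊆ A, ∀ i, some i ∈ C ↔ i ∈ SB C ∧ some i ∈ A := by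
      intro C hC i
      rw [hmem]
      constructor
      · intro h; exact ⟨⟨fun _ => h, Or.inl h⟩, hC h⟩
      · rintro ⟨⟨h1, -⟩, h3⟩; exact h1 h3
    apply Subtype.ext
    ext v
    cases v with
    | none => exact ⟨fun h => absurd (hB h) hyA, fun h => absurd (hB' h) hyA⟩
    | some i => rw [hback B hB, hback B' hB', h2]
  have := Nat.card_le_card_of_injective g hg
  rw [Nat.card_eq_fintype_card, Fintype.card_coe, Finset.card_powerset] at this
  exact this


section growth
variable {V : Type*} [Fintype V] [DecidableEq V] (N : V → Finset V)

/-- Closed neighbourhood. -/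
def cl (I : Finset V) : Finset V := I ∪ I.biUnion N

/-- Frontier. -/
def fr (I : Finset V) : Finset V := cl N I \ I

/-- Dead frontier vertices. -/
def dead (I : Finset V) : Finset V := (fr N I).filter (fun v => N v ⊆ cl N I)

/-- The invariant of the greedy growth. -/
def Good (y : V) (H I : Finset V) : Prop :=
  y ∈ I ∧ (∀ v ∈ cl N I, TR (fun a b => b ∈ N a) {w | w ∉ I} y v) ∧
    (H ∩ cl N I).card ≤ 3 * (fr N I).card + (dead N I).card + 1

variable {N}

theorem TR.mono {R : V → V → Prop} {A B : Set V} {y v : V} (h : TR R A y v) (hBA : B ⊆ A) :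
    TR R B y v := by
  induction h with
  | start => exact .start
  | step _ h2 h3 ih => exact .step ih (fun h => h2 (hBA h)) h3

theorem mem_cl {I : Finset V} {v : V} : v ∈ cl N I ↔ v ∈ I ∨ ∃ u ∈ I, v ∈ N u := by
  simp [cl]

theorem mem_fr {I : Finset V} {v : V} : v ∈ fr N I ↔ v ∈ cl N I ∧ v ∉ I := by
  simp [fr]

theorem mem_dead {I : Finset V} {v : V} : v ∈ dead N I ↔ v ∈ fr N I ∧ N v ⊆ cl N I := by
  simp [dead]

theorem cl_insert {I : Finset V} {x : V} (hx : x ∈ cl N I) :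
    cl N (insert x I) = cl N I ∪ (N x \ cl N I) := by
  ext v
  rw [Finset.mem_union, Finset.mem_sdiff, mem_cl]
  simp only [Finset.mem_insert, exists_eq_or_imp]
  constructor
  · rintro ((rfl | h) | h | h)
    · exact Or.inl hx
    · exact Or.inl (mem_cl.2 (Or.inl h))
    · by_cases h' : v ∈ cl N I
      · exact Or.inl h'
      · exact Or.inr ⟨h, h'⟩
    · exact Or.inl (mem_cl.2 (Or.inr h))
  · rintro (h | h)
    · rcases mem_cl.1 h with h | h
      · exact Or.inl (Or.inr h)
      · exact Or.inr (Or.inr h)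
    · exact Or.inr (Or.inl h.1)

theorem fr_insert {I : Finset V} {x : V} (hx : x ∈ fr N I) :
    (fr N (insert x I)).card + 1 = (fr N I).card + (N x \ cl N I).card := by
  have hx' := mem_fr.1 hx
  have h1 : fr N (insert x I) = (fr N I).erase x ∪ (N x \ cl N I) := by
    ext v
    rw [mem_fr, cl_insert hx'.1]
    simp only [Finset.mem_union, Finset.mem_erase, Finset.mem_insert, mem_fr, Finset.mem_sdiff]
    have h2 : v ∈ I → v ∈ cl N I := fun h => mem_cl.2 (Or.inl h)
    have h3 : v = x → v ∈ cl N I := fun h => h ▸ hx'.1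
    tauto
  have hdis : Disjoint ((fr N I).erase x) (N x \ cl N I) := by
    rw [Finset.disjoint_left]
    intro v hv hv'
    exact (Finset.mem_sdiff.1 hv').2 (mem_fr.1 (Finset.mem_of_mem_erase hv)).1
  rw [h1, Finset.card_union_of_disjoint hdis]
  have := Finset.card_erase_add_one hx
  omega

theorem dead_insert {I : Finset V} {x : V} (hx : x ∈ fr N I) (ho : (N x \ cl N I).Nonempty) :
    dead N I ⊆ dead N (insert x I) := by
  intro v hv
  have hx' := mem_fr.1 hx
  rw [mem_dead, mem_fr] at hv ⊢
  rw [cl_insert hx'.1]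
  obtain ⟨o, ho⟩ := ho
  rw [Finset.mem_sdiff] at ho
  refine ⟨⟨Finset.mem_union_left _ hv.1.1, ?_⟩, hv.2.trans Finset.subset_union_left⟩
  rw [Finset.mem_insert]
  rintro (rfl | h)
  · exact ho.2 (hv.2 ho.1)
  · exact hv.1.2 h

theorem TR_insert {I : Finset V} {x y : V} (hx : x ∈ fr N I)
    (h : ∀ v ∈ cl N I, TR (fun a b => b ∈ N a) {w | w ∉ I} y v) :
    ∀ v ∈ cl N (insert x I), TR (fun a b => b ∈ N a) {w | w ∉ insert x I} y v := by
  intro v hv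
  have hx' := mem_fr.1 hx
  have hsub : {w | w ∉ insert x I} ⊆ {w | w ∉ I} := by
    intro w hw hw'; exact hw (Finset.mem_insert_of_mem hw')
  rw [cl_insert hx'.1, Finset.mem_union, Finset.mem_sdiff] at hv
  rcases hv with hv | hv
  · exact (h v hv).mono hsub
  · exact TR.step ((h x hx'.1).mono hsub) (by simp) hv.1

theorem card_inter_insert {H I : Finset V} {x : V} (hx : x ∈ fr N I) :
    (H ∩ cl N (insert x I)).card ≤ (H ∩ cl N I).card + (H ∩ (N x \ cl N I)).card := by
  rw [cl_insert (mem_fr.1 hx).1, Finset.inter_union_distrib_left]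
  exact Finset.card_union_le _ _

theorem grow (hsymm : ∀ a b, a ∈ N b → b ∈ N a) (hirr : ∀ a, a ∉ N a)
    {y : V} {H I : Finset V} (hH : ∀ v ∈ H, 3 ≤ (N v).card)
    (hconn : ∀ v, Relation.ReflTransGen (fun a b => b ∈ N a) y v)
    (hI : Good N y H I) (hne : cl N I ≠ Finset.univ) : ∃ J, Good N y H J ∧ I.card < J.card := by
  obtain ⟨hy, hT, hc⟩ := hI
  have hle : ∀ B : Finset V, (H ∩ B).card ≤ B.card := fun B =>
    Finset.card_le_card Finset.inter_subset_right
  have hex : ∃ x ∈ cl N I, (N x \ cl N I).Nonempty := by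
    by_contra hcon
    push Not at hcon
    apply hne
    rw [Finset.eq_univ_iff_forall]
    intro v
    induction hconn v with
    | refl => exact mem_cl.2 (Or.inl hy)
    | tail _ h2 ih =>
      by_contra h3
      have := hcon _ ih
      exact absurd (Finset.mem_sdiff.2 ⟨h2, h3⟩) (by simp [this])
  obtain ⟨x, hxc, hxo⟩ := hex
  have frOf : ∀ z ∈ cl N I, ∀ o ∈ N z, o ∉ cl N I → z ∈ fr N I := by
    intro z hz o ho hoc
    refine mem_fr.2 ⟨hz, fun hzI => hoc (mem_cl.2 (Or.inr ⟨z, hzI, ho⟩))⟩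
  have hcard : ∀ z ∈ fr N I, (insert z I).card = I.card + 1 := fun z hz =>
    Finset.card_insert_of_notMem (mem_fr.1 hz).2
  by_cases h1 : ∃ x ∈ fr N I, 2 ≤ (N x \ cl N I).card
  · obtain ⟨x, hx, hr⟩ := h1
    refine ⟨insert x I, ⟨Finset.mem_insert_of_mem hy, TR_insert hx hT, ?_⟩, by rw [hcard x hx]; omega⟩
    have a1 := card_inter_insert (H := H) hx
    have a2 := hle (N x \ cl N I)
    have a3 := fr_insert hx
    have a4 := Finset.card_le_card (dead_insert hx (Finset.card_pos.1 (by omega)))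
    omega
  · push Not at h1
    obtain ⟨o, ho⟩ := hxo
    have ho' := Finset.mem_sdiff.1 ho
    have hx : x ∈ fr N I := frOf x hxc o ho'.1 ho'.2
    have hone : ∀ z ∈ fr N I, o ∈ N z → N z \ cl N I = {o} := by
      intro z hz hoz
      symm
      apply Finset.eq_of_subset_of_card_le
      · simpa using ⟨hoz, ho'.2⟩
      · have := h1 z hz
        simp; omega
    have hxo := hone x hx ho'.1
    have b1 := card_inter_insert (H := H) hx
    have b2 := hle (N x \ cl N I)
    have b3 := fr_insert hx
    have b4 := dead_insert hx ⟨o, ho⟩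
    have b4' := Finset.card_le_card b4
    have b5 := TR_insert hx hT
    have hcl := cl_insert hxc
    have hoI : o ∉ I := fun h => ho'.2 (mem_cl.2 (Or.inl h))
    have hox : o ≠ x := by rintro rfl; exact ho'.2 hxc
    have hof : o ∈ fr N (insert x I) := by
      rw [mem_fr, hcl, hxo]
      simp [hoI, hox]
    rw [hxo, Finset.card_singleton] at b3 b2
    by_cases h2 : 2 ≤ (N o \ cl N (insert x I)).card
    · refine ⟨insert o (insert x I), ⟨by simp [hy], TR_insert hof b5, ?_⟩, ?_⟩
      · have a1 := card_inter_insert (H := H) hof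
        have a2 := hle (N o \ cl N (insert x I))
        have a3 := fr_insert hof
        have a4 := Finset.card_le_card (dead_insert hof (Finset.card_pos.1 (by omega)))
        rw [hxo] at b1
        omega
      · have := (mem_fr.1 hof).2
        rw [Finset.card_insert_of_notMem this, hcard x hx]; omega
    · refine ⟨insert x I, ⟨Finset.mem_insert_of_mem hy, b5, ?_⟩, by rw [hcard x hx]; omega⟩
      rw [hxo] at b1
      by_cases hoH : o ∈ H
      · have h3 := hH o hoH
        have h4 : 2 ≤ (N o ∩ cl N I).card := by
          have e1 := Finset.card_inter_add_card_sdiff (N o) (cl N (insert x I))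
          have e2 : N o ∩ cl N (insert x I) = N o ∩ cl N I := by
            rw [hcl, hxo]
            ext v
            simp only [Finset.mem_inter, Finset.mem_union, Finset.mem_singleton]
            have : v = o → v ∉ N o := by rintro rfl; exact hirr _
            tauto
          rw [e2] at e1
          omega
        obtain ⟨z, hz, hzx⟩ := Finset.exists_mem_ne (by omega) x (s := N o ∩ cl N I)
        rw [Finset.mem_inter] at hz
        have hoz := hsymm _ _ hz.1
        have hzf : z ∈ fr N I := frOf z hz.2 o hoz ho'.2
        have hzd : z ∉ dead N I := fun h => ho'.2 ((mem_dead.1 h).2 hoz)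
        have hzd' : z ∈ dead N (insert x I) := by
          rw [mem_dead, mem_fr, hcl, hxo]
          refine ⟨⟨Finset.mem_union_left _ hz.2, ?_⟩, ?_⟩
          · simp [hzx, (mem_fr.1 hzf).2]
          · rw [← hone z hzf hoz]
            intro v hv
            simp [hv]
        have b6 : (dead N I).card < (dead N (insert x I)).card :=
          Finset.card_lt_card ⟨b4, fun h => hzd (h hzd')⟩
        have := hle {o}
        rw [Finset.card_singleton] at this
        omega
      · have : H ∩ {o} = ∅ := by simp [hoH]
        rw [this, Finset.card_empty] at b1
        omega

theorem good_start (y : V) (H : Finset V) : Good N y H {y} := by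
  refine ⟨by simp, ?_, ?_⟩
  · intro v hv
    rcases mem_cl.1 hv with h | ⟨u, hu, h⟩
    · rw [Finset.mem_singleton] at h
      rw [h]; exact .start
    · rw [Finset.mem_singleton] at hu
      subst hu
      exact TR.step .start (by simp) h
  · have h1 : (H ∩ cl N {y}).card ≤ (cl N {y}).card := Finset.card_le_card Finset.inter_subset_right
    have h2 : (cl N {y}).card ≤ (fr N {y}).card + 1 := by
      have := Finset.le_card_sdiff ({y} : Finset V) (cl N {y})
      simp only [Finset.card_singleton] at this
      unfold fr
      omega
    omega

theorem exists_leaves (hsymm : ∀ a b, a ∈ N b → b ∈ N a) (hirr : ∀ a, a ∉ N a)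
    {y : V} {H : Finset V} (hH : ∀ v ∈ H, 3 ≤ (N v).card)
    (hconn : ∀ v, Relation.ReflTransGen (fun a b => b ∈ N a) y v) :
    ∃ A : Finset V, y ∉ A ∧ (∀ v, TR (fun a b => b ∈ N a) (A : Set V) y v) ∧
      H.card ≤ 4 * A.card + 1 := by
  classical
  obtain ⟨I, hI, hmax⟩ := Finset.exists_max_image (Finset.univ.filter (fun I => Good N y H I))
    Finset.card ⟨{y}, by simp [good_start]⟩
  simp only [Finset.mem_filter, Finset.mem_univ, true_and] at hI hmax
  have hcl : cl N I = Finset.univ := by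
    by_contra hne
    obtain ⟨J, hJ, hlt⟩ := grow hsymm hirr hH hconn hI hne
    exact absurd (hmax J hJ) (by omega)
  obtain ⟨hy, hT, hc⟩ := hI
  refine ⟨fr N I, fun h => (mem_fr.1 h).2 hy, ?_, ?_⟩
  · intro v
    refine (hT v (by simp [hcl])).mono ?_
    intro w hw
    exact (mem_fr.1 hw).2
  · have : (dead N I).card ≤ (fr N I).card := Finset.card_le_card (Finset.filter_subset _ _)
    rw [hcl, Finset.inter_univ] at hc
    omega

end growth

theorem NG_bound {ι : Type*} [Fintype ι] [DecidableEq ι] (G : DAG (Option ι))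
    (hconn : ∀ a b, Relation.ReflTransGen (SkelAdj G) a b) :
    ∃ a : ℕ, numHighDeg G ≤ 4 * a + 1 ∧ 2 ^ a ≤ NG G := by
  classical
  let N : Option ι → Finset (Option ι) := fun v => Finset.univ.filter (fun w => SkelAdj G v w)
  have hN : ∀ v w, w ∈ N v ↔ SkelAdj G v w := by intro v w; simp [N]
  have hrel : (fun a b => b ∈ N a) = SkelAdj G := by
    funext a b; exact propext (hN a b)
  let H : Finset (Option ι) := Finset.univ.filter (fun v => 3 ≤ skelDeg G v)
  have hdeg : ∀ v, skelDeg G v = (N v).card := by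
    intro v
    unfold skelDeg
    rw [Nat.card_coe_set_eq, ← Set.ncard_coe_finset]
    congr 1
    ext w; simp [N]
  have hnum : numHighDeg G = H.card := by
    unfold numHighDeg
    rw [Nat.card_coe_set_eq, ← Set.ncard_coe_finset]
    congr 1
    ext w; simp [H]
  obtain ⟨A, hyA, hT, hcard⟩ := exists_leaves (N := N) (y := none) (H := H)
    (fun a b h => by rw [hN] at *; exact h.symm)
    (fun a h => by
      rw [hN] at h
      exact G.acyclic a (.single (by rcases h with h | h <;> exact h)))
    (fun v hv => by rw [← hdeg]; simpa [H] using hv)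
    (fun v => by rw [hrel]; exact hconn _ _)
  rw [hrel] at hT
  exact ⟨A.card, by rw [hnum]; exact hcard, two_pow_le G A hyA hT⟩

end NGaux

/-- Let `(G_n)` be a sequence of connected DAGs over a target `Y` and
`d_n` covariates with `d_n → ∞`. If `d_{>2}(G_n)/log d_n → ∞` then `N_{G_n}` grows
superpolynomially in `d_n`: for every `m`, `N_{G_n}/d_n^m → ∞`. -/
theorem NG_superpolynomial (d : ℕ → ℕ) (G : ∀ n, DAG (Option (Fin (d n))))
    (hconn : ∀ n, ∀ a b : Option (Fin (d n)), Relation.ReflTransGen (SkelAdj (G n)) a b)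
    (hd : Filter.Tendsto d Filter.atTop Filter.atTop)
    (hratio : Filter.Tendsto (fun n => (numHighDeg (G n) : ℝ) / Real.log (d n))
      Filter.atTop Filter.atTop) :
    ∀ m : ℕ, Filter.Tendsto (fun n => (NG (G n) : ℝ) / (d n : ℝ) ^ m)
      Filter.atTop Filter.atTop := by
  intro m
  have hdr : Filter.Tendsto (fun n => (1/2 : ℝ) * (d n : ℝ)) Filter.atTop Filter.atTop :=
    (tendsto_natCast_atTop_atTop.comp hd).const_mul_atTop (by norm_num)
  refine Filter.tendsto_atTop_mono' _ ?_ hdr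
  filter_upwards [hratio.eventually_ge_atTop (8 * ((m : ℝ) + 1)), hd.eventually_ge_atTop 2] with n h1 h2
  obtain ⟨a, ha, hNG⟩ := NGaux.NG_bound (G n) (hconn n)
  have hd2 : (2 : ℝ) ≤ d n := by exact_mod_cast h2
  have hlog : 0 < Real.log (d n) := Real.log_pos (by linarith)
  rw [le_div_iff₀ hlog] at h1
  have ha' : (numHighDeg (G n) : ℝ) ≤ 4 * a + 1 := by exact_mod_cast ha
  have hNG' : (2 : ℝ) ^ a ≤ NG (G n) := by exact_mod_cast hNG
  rw [le_div_iff₀ (by positivity)]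
  refine le_trans ?_ hNG'
  have hl2 := Real.log_two_gt_d9
  have key : ((m + 1 : ℕ) : ℝ) * Real.log (d n) ≤ ((a + 1 : ℕ) : ℝ) * Real.log 2 := by
    push_cast
    have h3 : 2 * (((m : ℝ) + 1) * Real.log (d n)) ≤ a + 1 := by nlinarith
    nlinarith
  rw [← Real.log_pow, ← Real.log_pow, Real.log_le_log_iff (by positivity) (by positivity)] at key
  rw [pow_succ, pow_succ] at key
  linarith
end

section
/- Let G be a finite DAG over variables {Y} ∪ X, each taking values in a finite set, let X_M ⊆ X, X_M⁰ := X_M ∩ Ch(Y), X_M¹ := X_M ∖ X_M⁰, and let S index the stable variables X_S := X ∖ X_M. Suppose strictly positive conditional probability tables p(y | pa(y)), p(x_i | pa(x_i)) for i ∈ S, and q_i(x_i | pa(x_i)) for X_i ∈ X_M¹ are given, where pa(·) denotes the values of the parents in G read off a full assignment. For a full assignment v of all variables define A(v) := p(y | pa(y)) · ∏_{i ∈ S} p(x_i | pa(x_i)) and B(v) := A(v) · ∏_{X_i ∈ X_M¹} q_i(x_i | pa(x_i)). Then for every full assignment v, A(v)/Σ_{y'} A(v[y ← y']) = B(v)/Σ_{y'}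 B(v[y ← y']), where v[y ← y'] replaces the value of Y by y'. In causal notation: p(y | x_S, do(x_M)) = p(y | x_S, x_M¹, do(x_M⁰)). -/
/-- A finite directed acyclic graph on a vertex type `V`: an edge relation with no
directed cycles. -/
structure FinDAG (V : Type*) where
  edge : V → V → Prop
  acyclic : ∀ v, ¬ Relation.TransGen edge v v

/-- Let `G` be a finite DAG over `{Y} ∪ X` with finitely-valued
variables, `X_M ⊆ X`, `X_M⁰ := X_M ∩ Ch(Y)`, `X_M¹ := X_M ∖ X_M⁰`, and let `S` index
the stable variables `X_S := X ∖ X_M`. Given strictly positive conditional probability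
tables `py` for `Y`, `ps i` for `i ∈ S` and `q i` for `i ∈ X_M¹` (each depending only on
the value of its variable and of its parents in `G`), define
`A(v) := py(v)·∏_{i ∈ S} ps_i(v)` and `B(v) := A(v)·∏_{i ∈ X_M¹} q_i(v)`. Then for
every full assignment `σ`, `A(σ)/Σ_{y'} A(σ[y←y']) = B(σ)/Σ_{y'} B(σ[y←y'])`; in causal
notation, `p(y | x_S, do(x_M)) = p(y | x_S, x_M¹, do(x_M⁰))`. -/
theorem do_on_nonchildren_degenerates
    {V : Type*} [Fintype V] [DecidableEq V] {α : Type*} [Fintype α]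
    (G : FinDAG V) (y0 : V) (XM : Set V) (hy0 : y0 ∉ XM)
    (py : (V → α) → ℝ) (ps : V → (V → α) → ℝ) (q : V → (V → α) → ℝ)
    (hpy_pos : ∀ σ, 0 < py σ)
    (hps_pos : ∀ v σ, 0 < ps v σ)
    (hq_pos : ∀ v σ, 0 < q v σ)
    (hpy_local : ∀ σ σ' : V → α, σ y0 = σ' y0 → (∀ w, G.edge w y0 → σ w = σ' w) →
      py σ = py σ')
    (hps_local : ∀ v (σ σ' : V → α), σ v = σ' v → (∀ w, G.edge w v → σ w = σ' w) →
      ps v σ = ps v σ')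
    (hq_local : ∀ v (σ σ' : V → α), σ v = σ' v → (∀ w, G.edge w v → σ w = σ' w) →
      q v σ = q v σ') :
    let S : Set V := {v | v ≠ y0 ∧ v ∉ XM}
    let XM1 : Set V := {v | v ∈ XM ∧ ¬ G.edge y0 v}
    let A : (V → α) → ℝ := fun τ => py τ * ∏ v : V, S.mulIndicator (fun u => ps u τ) v
    let B : (V → α) → ℝ := fun τ => A τ * ∏ v : V, XM1.mulIndicator (fun u => q u τ) v
    ∀ σ : V → α,
      A σ / (∑ y' : α, A (Function.update σ y0 y')) =
        B σ / (∑ y' : α, B (Function.update σ y0 y')) := by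
  intro S XM1 A B σ
  have hQ : ∀ y' : α, (∏ v : V, XM1.mulIndicator (fun u => q u (Function.update σ y0 y')) v)
      = ∏ v : V, XM1.mulIndicator (fun u => q u σ) v := by
    intro y'
    refine Finset.prod_congr rfl fun v _ => ?_
    by_cases hv : v ∈ XM1
    · rw [Set.mulIndicator_of_mem hv, Set.mulIndicator_of_mem hv]
      apply hq_local
      · have hne : v ≠ y0 := fun h => hy0 (h ▸ hv.1)
        exact Function.update_of_ne hne _ _
      · intro w hw
        have hne : w ≠ y0 := fun h => hv.2 (h ▸ hw)
        exact Function.update_of_ne hne _ _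
    · rw [Set.mulIndicator_of_notMem hv, Set.mulIndicator_of_notMem hv]
  have hpos : 0 < ∏ v : V, XM1.mulIndicator (fun u => q u σ) v := by
    refine Finset.prod_pos fun v _ => ?_
    by_cases hv : v ∈ XM1
    · rw [Set.mulIndicator_of_mem hv]
      exact hq_pos _ _
    · rw [Set.mulIndicator_of_notMem hv]
      exact one_pos
  have hB : ∑ y' : α, B (Function.update σ y0 y')
      = (∑ y' : α, A (Function.update σ y0 y')) *
        ∏ v : V, XM1.mulIndicator (fun u => q u σ) v := by
    rw [Finset.sum_mul]
    refine Finset.sum_congr rfl fun y' _ => ?_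
    rw [← hQ y']
  rw [hB]
  exact (mul_div_mul_right _ _ hpos.ne').symm
end
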